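/- arXiv:1911.10431 — 7 statements merged into one kernel-verified Lean document; each statement's English description precedes it below -/
import Mathlib

section
/- Let Ω be a subset of the hyperbolic upper half-plane ℍ, let K₁, K₂ ≥ 0, and let φ, ψ : Ω → ℍ be maps that are K₁-Lipschitz and K₂-Lipschitz respectively (with respect to the hyperbolic distance of ℍ on both sides). Suppose Υ : Ω → ℍ satisfies dist(φ(x), Υ(x)) = dist(Υ(x), ψ(x)) = dist(φ(x), ψ(x))/2 for every x ∈ Ω (i.e. Υ(x) is the hyperbolic midpoint of φ(x) and ψ(x)). Then Υ is ((K₁ + K₂)/2)-Lipschitz. (This is Theorem 4.6 of the paper, 'average of Lipschitz maps', in the simply connected case où the surfaces are subsets of ℍ.) -/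
open UpperHalfPlane

theorem Real.cosh_eq_two_mul_cosh_half_sq_sub_one (t : ℝ) :
    Real.cosh t = 2 * Real.cosh (t / 2) ^ 2 - 1 := by
  have h := Real.cosh_two_mul (t / 2)
  rw [mul_div_cancel₀ t two_ne_zero, Real.sinh_sq] at h
  linarith

namespace UpperHalfPlane

theorem exists_forall_cosh_dist_eq (a b : ℍ) :
    ∃ q : ℍ, ∀ p : ℍ, Real.cosh (dist q p) =
      (Real.cosh (dist a p) + Real.cosh (dist b p)) / (2 * Real.cosh (dist a b / 2)) := by
  have ha := a.im_pos
  have hb := b.im_pos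
  have hk : 0 < Real.cosh (dist a b / 2) := Real.cosh_pos _
  have hk2 : 4 * a.im * b.im * Real.cosh (dist a b / 2) ^ 2 =
      (a.re - b.re) ^ 2 + (a.im + b.im) ^ 2 := by
    have h1 := Real.cosh_eq_two_mul_cosh_half_sq_sub_one (dist a b)
    rw [cosh_dist', div_eq_iff (by positivity)] at h1
    linarith
  generalize Real.cosh (dist a b / 2) = k at hk hk2
  refine ⟨mk ⟨(a.re * b.im + b.re * a.im) / (a.im + b.im),
    2 * k * a.im * b.im / (a.im + b.im)⟩ (by positivity), fun p => ?_⟩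
  have hp := p.im_pos
  simp only [cosh_dist', mk_re, mk_im]
  field_simp
  linear_combination (a.im * b.im) * hk2

/-- The hyperbolic median formula. -/
theorem cosh_dist_midpoint {a b m : ℍ} (h₁ : dist a m = dist a b / 2)
    (h₂ : dist m b = dist a b / 2) (p : ℍ) :
    Real.cosh (dist m p) =
      (Real.cosh (dist a p) + Real.cosh (dist b p)) / (2 * Real.cosh (dist a b / 2)) := by
  obtain ⟨q, hq⟩ := exists_forall_cosh_dist_eq a b
  have hqm : q = m := by
    have h := hq m
    rw [h₁, dist_comm b m, h₂, ← two_mul, div_self (by positivity)] at h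
    by_contra hne
    exact (Real.one_lt_cosh.2 (dist_ne_zero.2 hne)).ne' h
  exact hqm ▸ hq p

theorem exists_midpoint (a b : ℍ) :
    ∃ m : ℍ, dist a m = dist a b / 2 ∧ dist m b = dist a b / 2 := by
  obtain ⟨q, hq⟩ := exists_forall_cosh_dist_eq a b
  have hk : 0 < Real.cosh (dist a b / 2) := Real.cosh_pos _
  have h1 := Real.cosh_eq_two_mul_cosh_half_sq_sub_one (dist a b)
  have key : ∀ p : ℍ, Real.cosh (dist q p) = Real.cosh (dist a b / 2) →
      dist q p = dist a b / 2 := fun p h =>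
    Real.cosh_strictMonoOn.injOn (Set.mem_Ici.2 dist_nonneg)
      (Set.mem_Ici.2 (by positivity)) h
  refine ⟨q, ?_, ?_⟩
  · rw [dist_comm]
    apply key
    rw [hq, dist_self, Real.cosh_zero, dist_comm b a, h1]
    field_simp
    ring
  · apply key
    rw [hq, dist_self, Real.cosh_zero, h1]
    field_simp
    ring

/-- The segment joining the midpoints of two sides of a hyperbolic triangle is at most half as
long as the third side. -/
theorem dist_midpoint_midpoint_le_half {a b c m n : ℍ}
    (hm₁ : dist a m = dist a b / 2) (hm₂ : dist m b = dist a b / 2)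
    (hn₁ : dist b n = dist b c / 2) (hn₂ : dist n c = dist b c / 2) :
    dist m n ≤ dist a c / 2 := by
  have hdbl := Real.cosh_eq_two_mul_cosh_half_sq_sub_one
  have hX : 0 < Real.cosh (dist a b / 2) := Real.cosh_pos _
  have hY : 0 < Real.cosh (dist b c / 2) := Real.cosh_pos _
  have hupper : Real.cosh (dist a c / 2) ≤ Real.cosh (dist a b / 2 + dist b c / 2) := by
    rw [Real.cosh_le_cosh, abs_of_nonneg (by positivity), abs_of_nonneg (by positivity)]
    linarith [dist_triangle a b c]
  have hlower : Real.cosh (dist a b / 2 - dist b c / 2) ≤ Real.cosh (dist a c / 2) := by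
    rw [Real.cosh_le_cosh, abs_of_nonneg (by positivity : 0 ≤ dist a c / 2), abs_le]
    constructor
    · linarith [dist_triangle b a c, dist_comm a b]
    · linarith [dist_triangle a c b, dist_comm b c]
  have hmain : Real.cosh (dist m n) ≤ Real.cosh (dist a c / 2) := by
    rw [dist_comm m n, cosh_dist_midpoint hn₁ hn₂, dist_comm b m, dist_comm c m,
      cosh_dist_midpoint hm₁ hm₂, cosh_dist_midpoint hm₁ hm₂, dist_self, Real.cosh_zero,
      hdbl (dist a b), hdbl (dist b c), hdbl (dist a c)]
    rw [Real.cosh_add] at hupper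
    rw [Real.cosh_sub] at hlower
    have hsx := Real.sinh_sq (dist a b / 2)
    have hsy := Real.sinh_sq (dist b c / 2)
    generalize Real.cosh (dist a b / 2) = X at *
    generalize Real.cosh (dist b c / 2) = Y at *
    generalize Real.cosh (dist a c / 2) = Z at *
    generalize Real.sinh (dist a b / 2) = S at *
    generalize Real.sinh (dist b c / 2) = T at *
    have hST : S ^ 2 * T ^ 2 = (X ^ 2 - 1) * (Y ^ 2 - 1) := by rw [hsx, hsy]
    have hprod := mul_nonneg (sub_nonneg.2 hupper) (sub_nonneg.2 hlower)
    field_simp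
    nlinarith
  rwa [Real.cosh_le_cosh, abs_of_nonneg dist_nonneg, abs_of_nonneg (by positivity)] at hmain

/-- Busemann convexity of the hyperbolic plane, at midpoints. -/
theorem dist_midpoint_midpoint_le {a b c d m n : ℍ}
    (hm₁ : dist a m = dist a b / 2) (hm₂ : dist m b = dist a b / 2)
    (hn₁ : dist c n = dist c d / 2) (hn₂ : dist n d = dist c d / 2) :
    dist m n ≤ (dist a c + dist b d) / 2 := by
  obtain ⟨q, hq₁, hq₂⟩ := exists_midpoint b c
  have h₁ := dist_midpoint_midpoint_le_half hm₁ hm₂ hq₁ hq₂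
  have h₂ := dist_midpoint_midpoint_le_half hq₁ hq₂ hn₁ hn₂
  linarith [dist_triangle m q n]

end UpperHalfPlane

/-- **Average of Lipschitz maps** (Theorem 4.6 of the paper, simply connected case).
If `φ, ψ : Ω → ℍ` are `K₁`- and `K₂`-Lipschitz maps on a subset `Ω` of the hyperbolic
plane, and `Υ` sends each point `x` to the hyperbolic midpoint of `φ x` and `ψ x`,
then `Υ` is `((K₁ + K₂)/2)`-Lipschitz. -/
theorem average_of_lipschitz_maps
    (Ω : Set ℍ) (K₁ K₂ : ℝ) (hK₁ : 0 ≤ K₁) (hK₂ : 0 ≤ K₂)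
    (φ ψ Υ : Ω → ℍ)
    (hφ : ∀ x y : Ω, dist (φ x) (φ y) ≤ K₁ * dist (x : ℍ) (y : ℍ))
    (hψ : ∀ x y : Ω, dist (ψ x) (ψ y) ≤ K₂ * dist (x : ℍ) (y : ℍ))
    (hΥ : ∀ x : Ω, dist (φ x) (Υ x) = dist (φ x) (ψ x) / 2 ∧
      dist (Υ x) (ψ x) = dist (φ x) (ψ x) / 2) :
    ∀ x y : Ω, dist (Υ x) (Υ y) ≤ (K₁ + K₂) / 2 * dist (x : ℍ) (y : ℍ) := by
  intro x y
  have h := dist_midpoint_midpoint_le (hΥ x).1 (hΥ x).2 (hΥ y).1 (hΥ y).2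
  linarith [hφ x y, hψ x y]
end

section
/- Let Γ be a subgroup of SL(2, ℝ) and ρ : Γ → SL(2, ℝ) a group homomorphism. Let φ, ψ : ℍ → ℍ be maps satisfying the equivariance relations φ(γ•z) = ρ(γ)•φ(z) and ψ(γ•z) = ρ(γ)•ψ(z) for all γ ∈ Γ and z ∈ ℍ (where • is the Möbius action of SL(2, ℝ) on ℍ), with φ K₁-Lipschitz and ψ K₂-Lipschitz for the hyperbolic distance. Let Υ : ℍ → ℍ satisfy dist(φ(z), Υ(z)) = dist(Υ(z), ψ(z)) = dist(φ(z), ψ(z))/2 for all z (i.e. Υ(z) is the hyperbolic midpoint of φ(z) and ψ(z)). Then Υ(γ•z) = ρ(γ)•Υ(z) for all γ ∈ Γ and z ∈ ℍ, and Υ is ((K₁ + K₂)/2)-Lipschitz. (This is the equivariant content of Theorem 4.6 of the paper: the averaged map descends to quotient hyperbolic surfaces with Lipschitz constant at most the average.) -/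
open UpperHalfPlane Matrix

/-- Any two points `a`, `b` of `ℍ` admit a point `m` for which the hyperbolic parallelogram-type
identity `cosh d(z, a) + cosh d(z, b) = 2 cosh (d(a, b) / 2) cosh d(z, m)` holds for all `z`. -/
theorem UpperHalfPlane.exists_cosh_dist_add_cosh_dist (a b : ℍ) :
    ∃ m : ℍ, ∀ z : ℍ, Real.cosh (dist z a) + Real.cosh (dist z b) =
      2 * Real.cosh (dist a b / 2) * Real.cosh (dist z m) := by
  have hC : 0 < Real.cosh (dist a b / 2) := Real.cosh_pos _
  have hsq : 2 * Real.cosh (dist a b / 2) ^ 2 = 1 + Real.cosh (dist a b) := by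
    have h := Real.cosh_two_mul (dist a b / 2)
    rw [mul_div_cancel₀ _ two_ne_zero, Real.sinh_sq] at h
    linarith
  rw [UpperHalfPlane.cosh_dist'] at hsq
  set C := Real.cosh (dist a b / 2)
  have ha := a.im_pos
  have hb := b.im_pos
  have hm : 0 < 2 * C * a.im * b.im / (a.im + b.im) := by positivity
  refine ⟨⟨⟨(a.re * b.im + b.re * a.im) / (a.im + b.im), _⟩, hm⟩, fun z ↦ ?_⟩
  have hz := z.im_pos
  simp only [UpperHalfPlane.cosh_dist', UpperHalfPlane.mk_re, UpperHalfPlane.mk_im]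
  have hC2 : C ^ 2 = ((a.re - b.re) ^ 2 + (a.im + b.im) ^ 2) / (4 * a.im * b.im) := by
    field_simp at hsq ⊢
    linear_combination hsq
  have hm2 : (2 * C * a.im * b.im / (a.im + b.im)) ^ 2 =
      a.im * b.im * ((a.re - b.re) ^ 2 + (a.im + b.im) ^ 2) / (a.im + b.im) ^ 2 := by
    rw [div_pow, mul_pow, mul_pow, mul_pow, hC2]
    field_simp
    ring
  rw [hm2]
  field_simp
  ring

/-- The identity characterizing the midpoint `m` of `a` and `b` through distances to a third
point. -/
theorem UpperHalfPlane.cosh_dist_add_cosh_dist_of_midpoint {a b m : ℍ}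
    (ham : dist a m = dist a b / 2) (hmb : dist m b = dist a b / 2) (z : ℍ) :
    Real.cosh (dist z a) + Real.cosh (dist z b) =
      2 * Real.cosh (dist a b / 2) * Real.cosh (dist z m) := by
  obtain ⟨n, hn⟩ := UpperHalfPlane.exists_cosh_dist_add_cosh_dist a b
  have h := hn m
  rw [dist_comm m a, ham, hmb] at h
  have hC : 0 < Real.cosh (dist a b / 2) := Real.cosh_pos _
  have h1 : Real.cosh (dist m n) = 1 := by
    apply mul_left_cancel₀ hC.ne'
    linarith
  have hmn : m = n := by
    by_contra hne
    exact (Real.one_lt_cosh.2 (dist_pos.2 hne).ne').ne' h1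
  rw [hmn, hn z]

/-- Any two points of the hyperbolic plane have a midpoint. -/
theorem UpperHalfPlane.exists_midpoint_s1 (a b : ℍ) :
    ∃ m : ℍ, dist a m = dist a b / 2 ∧ dist m b = dist a b / 2 := by
  obtain ⟨m, hm⟩ := UpperHalfPlane.exists_cosh_dist_add_cosh_dist a b
  have hC : 0 < Real.cosh (dist a b / 2) := Real.cosh_pos _
  have hsq : 1 + Real.cosh (dist a b) =
      2 * Real.cosh (dist a b / 2) * Real.cosh (dist a b / 2) := by
    have h := Real.cosh_two_mul (dist a b / 2)
    rw [mul_div_cancel₀ _ two_ne_zero, Real.sinh_sq] at h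
    linarith
  have key {x : ℍ} (h : 1 + Real.cosh (dist a b) =
      2 * Real.cosh (dist a b / 2) * Real.cosh (dist x m)) : dist x m = dist a b / 2 := by
    have h' : Real.cosh (dist x m) = Real.cosh (dist a b / 2) :=
      mul_left_cancel₀ (by positivity) (h.symm.trans hsq)
    exact Real.cosh_strictMonoOn.injOn (Set.mem_Ici.2 dist_nonneg)
      (Set.mem_Ici.2 (by positivity)) h'
  refine ⟨m, key ?_, ?_⟩
  · simpa using hm a
  · rw [dist_comm m b]
    apply key
    rw [← hm b, dist_self, Real.cosh_zero, dist_comm b a, add_comm]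

/-- In a hyperbolic triangle, the segment joining the midpoints of two sides is at most half as
long as the third side. -/
theorem UpperHalfPlane.dist_midpoint_le_of_common_endpoint {a b c m n : ℍ}
    (ham : dist a m = dist a b / 2) (hmb : dist m b = dist a b / 2)
    (han : dist a n = dist a c / 2) (hnc : dist n c = dist a c / 2) :
    dist m n ≤ dist b c / 2 := by
  have h1 := UpperHalfPlane.cosh_dist_add_cosh_dist_of_midpoint ham hmb n
  have h2 := UpperHalfPlane.cosh_dist_add_cosh_dist_of_midpoint han hnc b
  rw [dist_comm n a, han, dist_comm n b, dist_comm n m] at h1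
  rw [dist_comm b a] at h2
  have hdouble (t : ℝ) : Real.cosh t = 2 * Real.cosh (t / 2) ^ 2 - 1 := by
    have h := Real.cosh_two_mul (t / 2)
    rw [mul_div_cancel₀ _ two_ne_zero, Real.sinh_sq] at h
    linarith
  rw [hdouble (dist a b), hdouble (dist b c)] at h2
  have hlow : Real.cosh (dist a b / 2 - dist a c / 2) ≤ Real.cosh (dist b c / 2) := by
    rw [Real.cosh_le_cosh, abs_of_nonneg (by positivity : 0 ≤ dist b c / 2), abs_le]
    constructor
    · linarith [dist_triangle a b c]
    · linarith [dist_triangle a c b, dist_comm b c]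
  have hupp : Real.cosh (dist b c / 2) ≤ Real.cosh (dist a b / 2 + dist a c / 2) := by
    rw [Real.cosh_le_cosh, abs_of_nonneg (by positivity), abs_of_nonneg (by positivity)]
    linarith [dist_triangle b a c, dist_comm a b]
  rw [Real.cosh_sub] at hlow
  rw [Real.cosh_add] at hupp
  have hS := Real.sinh_sq (dist a b / 2)
  have hS' := Real.sinh_sq (dist a c / 2)
  have hC : 0 < Real.cosh (dist a b / 2) := Real.cosh_pos _
  have hC' : 0 < Real.cosh (dist a c / 2) := Real.cosh_pos _
  suffices h : Real.cosh (dist m n) ≤ Real.cosh (dist b c / 2) by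
    rwa [Real.cosh_le_cosh, abs_of_nonneg dist_nonneg, abs_of_nonneg (by positivity)] at h
  set C := Real.cosh (dist a b / 2)
  set C' := Real.cosh (dist a c / 2)
  set S := Real.sinh (dist a b / 2)
  set S' := Real.sinh (dist a c / 2)
  set D := Real.cosh (dist b c / 2)
  have hprod : 0 ≤ (D - (C * C' - S * S')) * (C * C' + S * S' - D) :=
    mul_nonneg (sub_nonneg.2 hlow) (sub_nonneg.2 hupp)
  have hprod_eq : (D - (C * C' - S * S')) * (C * C' + S * S' - D) =
      2 * C * C' * D - (C ^ 2 + C' ^ 2 - 1 + D ^ 2) := by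
    linear_combination S' ^ 2 * hS + (C ^ 2 - 1) * hS'
  have heq : 2 * C * C' * Real.cosh (dist m n) = C ^ 2 + C' ^ 2 - 1 + D ^ 2 := by
    linear_combination -C' * h1 - h2 / 2
  refine le_of_mul_le_mul_left ?_ (by positivity : 0 < 2 * C * C')
  linarith

/-- Busemann convexity of the hyperbolic plane: the distance between the midpoints of two segments
is at most the average of the distances between their endpoints. -/
theorem UpperHalfPlane.dist_midpoint_midpoint_le_s1 {a b a' b' m m' : ℍ}
    (ham : dist a m = dist a b / 2) (hmb : dist m b = dist a b / 2)
    (ham' : dist a' m' = dist a' b' / 2) (hmb' : dist m' b' = dist a' b' / 2) :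
    dist m m' ≤ (dist a a' + dist b b') / 2 := by
  obtain ⟨n, han, hnb⟩ := UpperHalfPlane.exists_midpoint_s1 a b'
  have h1 := UpperHalfPlane.dist_midpoint_le_of_common_endpoint ham hmb han hnb
  rw [dist_comm n b', dist_comm a b'] at hnb
  rw [dist_comm a n, dist_comm a b'] at han
  rw [dist_comm m' b', dist_comm a' b'] at hmb'
  rw [dist_comm a' m', dist_comm a' b'] at ham'
  have h2 := UpperHalfPlane.dist_midpoint_le_of_common_endpoint hnb han hmb' ham'
  linarith [dist_triangle m n m']

/-- **Equivariant average of Lipschitz maps** (equivariant content of Theorem 4.6 of the paper).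
If `φ, ψ : ℍ → ℍ` are `(Γ, ρ)`-equivariant Lipschitz maps and `Υ` sends each point to the
hyperbolic midpoint of its images, then `Υ` is `(Γ, ρ)`-equivariant and
`((K₁ + K₂)/2)`-Lipschitz. -/
theorem equivariant_average_of_lipschitz_maps
    (Γ : Subgroup (SpecialLinearGroup (Fin 2) ℝ))
    (ρ : Γ →* SpecialLinearGroup (Fin 2) ℝ)
    (K₁ K₂ : ℝ) (φ ψ Υ : ℍ → ℍ)
    (hφeq : ∀ (γ : Γ) (z : ℍ), φ ((γ : SpecialLinearGroup (Fin 2) ℝ) • z) = ρ γ • φ z)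
    (hψeq : ∀ (γ : Γ) (z : ℍ), ψ ((γ : SpecialLinearGroup (Fin 2) ℝ) • z) = ρ γ • ψ z)
    (hφ : ∀ z w : ℍ, dist (φ z) (φ w) ≤ K₁ * dist z w)
    (hψ : ∀ z w : ℍ, dist (ψ z) (ψ w) ≤ K₂ * dist z w)
    (hΥ : ∀ z : ℍ, dist (φ z) (Υ z) = dist (φ z) (ψ z) / 2 ∧
      dist (Υ z) (ψ z) = dist (φ z) (ψ z) / 2) :
    (∀ (γ : Γ) (z : ℍ), Υ ((γ : SpecialLinearGroup (Fin 2) ℝ) • z) = ρ γ • Υ z) ∧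
      ∀ z w : ℍ, dist (Υ z) (Υ w) ≤ (K₁ + K₂) / 2 * dist z w := by
  refine ⟨fun γ z ↦ ?_, fun z w ↦ ?_⟩
  · have h := hΥ ((γ : SpecialLinearGroup (Fin 2) ℝ) • z)
    rw [hφeq, hψeq] at h
    have h' : dist (ρ γ • φ z) (ρ γ • Υ z) = dist (ρ γ • φ z) (ρ γ • ψ z) / 2 ∧
        dist (ρ γ • Υ z) (ρ γ • ψ z) = dist (ρ γ • φ z) (ρ γ • ψ z) / 2 := by
      simpa only [dist_smul] using hΥ z
    have hle := UpperHalfPlane.dist_midpoint_midpoint_le_s1 h.1 h.2 h'.1 h'.2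
    rw [dist_self, dist_self, add_zero, zero_div] at hle
    exact dist_le_zero.1 hle
  · have hle := UpperHalfPlane.dist_midpoint_midpoint_le_s1 (hΥ z).1 (hΥ z).2 (hΥ w).1 (hΥ w).2
    linarith [hφ z w, hψ z w]
end

section
/- Let s₁, s₂ ∈ ℝ satisfy s₁ + s₂ > 0, s₁ ≤ s₂, and 3e^{s₁+s₂} − e^{s₁} − e^{s₂} − 1 > 0. Set r = √(e^{s₂}(e^{s₁}+1)/(e^{s₂}+1)), E = −1 + i·r, A = ((e^{s₁+s₂} − 1)/(e^{s₁+s₂} + 2e^{s₂} + 1))·(1 + i·r), t = (1/2)·√((e^{s₁}+1)(3e^{s₁+s₂} − e^{s₁} − e^{s₂} − 1)/(e^{s₂}+1)), H = (e^{s₁}−1)/2 + i·t, and P = −1 + i·√(e^{s₁+s₂}(e^{s₁}+1)/(e^{s₂}+1)). Then all of A, E, H, P lie in ℍ and: (i) dist(H, A) = dist(H, E); (ii) P is the unique point of the vertical geodesic {w ∈ ℍ : Re w = −1} nearest to H; (iii) dist(P, E) = |s₁|/2. (This is Lemma 5.8 of the paper — the pentagon shear computation d±(H_DE, E) = s₁/2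 — in the explicit upper half-plane coordinates of its proof, where E, A are lifts of pentagon vertices, H is the intersection of the perpendicular bisector of the segment AE with the angle bisector at the ideal vertex ∞, and P = H_DE is the orthogonal projection of H to the geodesic through −1 and ∞.) -/
open UpperHalfPlane

/-- The distance between two points `z, w` of the upper half-plane is determined by the quotient
`((z.re - w.re)² + z.im² + w.im²) / (2 * z.im * w.im)`, monotonically. -/
theorem UpperHalfPlane.dist_le_dist_iff (z w u v : UpperHalfPlane) :
    dist z w ≤ dist u v ↔
      ((z.re - w.re) ^ 2 + z.im ^ 2 + w.im ^ 2) / (2 * z.im * w.im) ≤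
        ((u.re - v.re) ^ 2 + u.im ^ 2 + v.im ^ 2) / (2 * u.im * v.im) := by
  rw [← UpperHalfPlane.cosh_dist', ← UpperHalfPlane.cosh_dist', Real.cosh_le_cosh,
    abs_of_nonneg dist_nonneg, abs_of_nonneg dist_nonneg]

/-- If `P` lies on a vertical geodesic at the Euclidean height at which the circle around the foot
of that geodesic through `H` meets it, then `P` is the only point of the geodesic at distance at
most `dist H P` from `H`. -/
theorem UpperHalfPlane.eq_of_re_eq_of_dist_le {H P w : UpperHalfPlane}
    (hP : P.im ^ 2 = (H.re - P.re) ^ 2 + H.im ^ 2) (hw : w.re = P.re)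
    (h : dist H w ≤ dist H P) : w = P := by
  have hH := H.im_pos
  have hPi := P.im_pos
  have hwi := w.im_pos
  rw [UpperHalfPlane.dist_le_dist_iff, hw, ← hP, div_le_div_iff₀ (by positivity) (by positivity)]
    at h
  have key : 2 * H.im * P.im * (w.im - P.im) ^ 2 ≤ 0 := by nlinarith
  have hsq : (w.im - P.im) ^ 2 ≤ 0 := by
    by_contra! hc
    exact absurd key (not_le.mpr (by positivity))
  have him : w.im = P.im := by
    have := pow_eq_zero_iff two_ne_zero |>.mp (le_antisymm hsq (sq_nonneg _))
    linarith
  exact UpperHalfPlane.ext (Complex.ext hw him)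

/-- **Lemma 5.8 of the paper** (the pentagon shear computation `d±(H_DE, E) = s₁/2`) in
the explicit upper half-plane coordinates of its proof.  Here `E`, `A` are lifts of
pentagon vertices, `H` is the intersection of the perpendicular bisector of the segment
`AE` with the bisector of the ideal angle at `∞`, and `P = H_DE` is the orthogonal
projection of `H` to the vertical geodesic `{Re = -1}` through `-1` and `∞`.  Then
`dist(H,A) = dist(H,E)`, `P` is the unique nearest point of `{Re = -1}` to `H`, and
`dist(P,E) = |s₁|/2`. -/
theorem pentagon_shear_computation (s₁ s₂ : ℝ)
    (hsum : 0 < s₁ + s₂) (hle : s₁ ≤ s₂)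
    (hpos : 0 < 3 * Real.exp (s₁ + s₂) - Real.exp s₁ - Real.exp s₂ - 1)
    (r : ℝ) (hr : r = Real.sqrt (Real.exp s₂ * (Real.exp s₁ + 1) / (Real.exp s₂ + 1)))
    (A E H P : ℍ)
    (hE : (E : ℂ) = ⟨-1, r⟩)
    (hA : (A : ℂ) =
      ⟨(Real.exp (s₁ + s₂) - 1) / (Real.exp (s₁ + s₂) + 2 * Real.exp s₂ + 1),
       (Real.exp (s₁ + s₂) - 1) / (Real.exp (s₁ + s₂) + 2 * Real.exp s₂ + 1) * r⟩)
    (hH : (H : ℂ) =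
      ⟨(Real.exp s₁ - 1) / 2,
       1 / 2 * Real.sqrt ((Real.exp s₁ + 1) *
         (3 * Real.exp (s₁ + s₂) - Real.exp s₁ - Real.exp s₂ - 1) / (Real.exp s₂ + 1))⟩)
    (hP : (P : ℂ) =
      ⟨-1, Real.sqrt (Real.exp (s₁ + s₂) * (Real.exp s₁ + 1) / (Real.exp s₂ + 1))⟩) :
    dist H A = dist H E ∧
    ((P : ℂ).re = -1 ∧ ∀ w : ℍ, (w : ℂ).re = -1 →
      dist H P ≤ dist H w ∧ (dist H w = dist H P → w = P)) ∧
    dist P E = |s₁| / 2 := by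
  have hEre : E.re = -1 := congrArg Complex.re hE
  have hEim : E.im = r := congrArg Complex.im hE
  have hAre : A.re = _ := congrArg Complex.re hA
  have hAim : A.im = _ := congrArg Complex.im hA
  have hHre : H.re = _ := congrArg Complex.re hH
  have hHim : H.im = _ := congrArg Complex.im hH
  have hPre : P.re = -1 := congrArg Complex.re hP
  have hPim : P.im = _ := congrArg Complex.im hP
  have hr0 : 0 < r := hEim ▸ E.im_pos
  have hab : 1 < Real.exp (s₁ + s₂) := Real.one_lt_exp_iff.mpr hsum
  have hexp := Real.exp_add s₁ s₂
  have ha := Real.exp_pos s₁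
  have hb := Real.exp_pos s₂
  have ha2 : Real.exp s₁ = Real.exp (s₁ / 2) ^ 2 := by
    rw [← Real.exp_nat_mul]; congr 1; push_cast; ring
  have hPr : P.im = Real.exp (s₁ / 2) * r := by
    rw [hPim, hr, hexp, mul_assoc, mul_div_assoc, Real.sqrt_mul ha.le, ha2,
      Real.sqrt_sq (Real.exp_pos _).le]
  simp only at hAre hAim hHre hHim hPim
  rw [hexp] at hAre hAim hHim hPim hpos hab
  clear ha2
  set a := Real.exp s₁
  set b := Real.exp s₂
  have hr2 : r ^ 2 = b * (a + 1) / (b + 1) := by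
    rw [hr, Real.sq_sqrt (by positivity)]
  have hP2 : P.im ^ 2 = a * b * (a + 1) / (b + 1) := by
    rw [hPim, Real.sq_sqrt (by positivity)]
  have hH2 : H.im ^ 2 = (a + 1) * (3 * (a * b) - a - b - 1) / (b + 1) / 4 := by
    rw [hHim, mul_pow, Real.sq_sqrt (by positivity)]; ring
  have hHi := H.im_pos
  have hfoot : P.im ^ 2 = (H.re - P.re) ^ 2 + H.im ^ 2 := by
    rw [hP2, hH2, hHre, hPre]; field_simp; ring
  refine ⟨?_, ⟨hPre, fun w hw ↦ ?_⟩, ?_⟩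
  · have hk : 0 < a * b - 1 := by linarith
    have hA2 : A.im ^ 2 = ((a * b - 1) / (a * b + 2 * b + 1)) ^ 2 * (b * (a + 1) / (b + 1)) := by
      rw [hAim, mul_pow, hr2]
    have heq : ((H.re - A.re) ^ 2 + H.im ^ 2 + A.im ^ 2) / (2 * H.im * A.im) =
        ((H.re - E.re) ^ 2 + H.im ^ 2 + E.im ^ 2) / (2 * H.im * E.im) := by
      rw [hA2, hH2, hAim, hAre, hEim, hr2, hEre, hHre]
      field_simp
      ring
    exact le_antisymm ((UpperHalfPlane.dist_le_dist_iff ..).mpr heq.le)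
      ((UpperHalfPlane.dist_le_dist_iff ..).mpr heq.ge)
  · have huniq (h : dist H w ≤ dist H P) : w = P :=
      UpperHalfPlane.eq_of_re_eq_of_dist_le hfoot (hw.trans hPre.symm) h
    refine ⟨?_, fun h ↦ huniq h.le⟩
    by_contra! h
    exact h.ne (congrArg (dist H) (huniq h.le))
  · rw [UpperHalfPlane.dist_of_re_eq (hPre.trans hEre.symm), hPr, hEim,
      Real.log_mul (Real.exp_pos _).ne' hr0.ne', Real.log_exp, Real.dist_eq, add_sub_cancel_right,
      abs_div, abs_two]
end

section
/- Let a, b, a', b' ∈ ℍ, let m ∈ ℍ satisfy dist(a, m) = dist(m, b) = dist(a, b)/2, and let m' ∈ ℍ satisfy dist(a', m') = dist(m', b') = dist(a', b')/2 (so m, m' are hyperbolic midpoints of the pairs (a,b) and (a',b')). Then dist(m, m') ≤ (dist(a, a') + dist(b, b'))/2. (This midpoint-contraction inequality in the hyperbolic plane is the key estimate behind Lemma 4.4 and Theorem 4.6 of the paper: the average of two Lipschitz maps has Lipschitz constant at most the average of their constants.) -/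
open UpperHalfPlane

/-- Any two points `a`, `b` of the hyperbolic plane have a midpoint `m`, characterized by the
hyperbolic median formula for the distances from `m` to all other points. -/
theorem UpperHalfPlane.exists_cosh_dist_median (a b : ℍ) :
    ∃ m : ℍ, ∀ p : ℍ, 2 * Real.cosh (dist a b / 2) * Real.cosh (dist p m) =
      Real.cosh (dist p a) + Real.cosh (dist p b) := by
  have ha := a.im_pos
  have hb := b.im_pos
  set c := Real.cosh (dist a b / 2) with hc
  have hc0 : 0 < c := Real.cosh_pos _
  have hcsq : 2 * c ^ 2 = 1 + ((a.re - b.re) ^ 2 + a.im ^ 2 + b.im ^ 2) / (2 * a.im * b.im) := by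
    rw [← UpperHalfPlane.cosh_dist', show dist a b = 2 * (dist a b / 2) by ring,
      Real.cosh_two_mul, Real.sinh_sq, ← hc]
    ring
  have hcsq' : 4 * c ^ 2 * a.im * b.im = (a.re - b.re) ^ 2 + (a.im + b.im) ^ 2 := by
    field_simp at hcsq
    linear_combination hcsq
  refine ⟨⟨⟨(a.re * b.im + b.re * a.im) / (a.im + b.im), 2 * c * a.im * b.im / (a.im + b.im)⟩,
    by dsimp only; positivity⟩, fun p ↦ ?_⟩
  have hp := p.im_pos
  simp only [UpperHalfPlane.cosh_dist', UpperHalfPlane.mk_re, UpperHalfPlane.mk_im]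
  field_simp
  linear_combination (a.im * b.im) * hcsq'

/-- A hyperbolic midpoint satisfies the hyperbolic median formula. -/
theorem UpperHalfPlane.cosh_dist_of_midpoint {a b m : ℍ} (h₁ : dist a m = dist a b / 2)
    (h₂ : dist m b = dist a b / 2) (p : ℍ) :
    2 * Real.cosh (dist a b / 2) * Real.cosh (dist p m) =
      Real.cosh (dist p a) + Real.cosh (dist p b) := by
  obtain ⟨n, hn⟩ := UpperHalfPlane.exists_cosh_dist_median a b
  have h := hn m
  rw [dist_comm m a, h₁, h₂] at h
  have hc := Real.cosh_pos (dist a b / 2)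
  have hmn : Real.cosh (dist m n) = 1 :=
    mul_left_cancel₀ (mul_pos two_pos hc).ne' (by linarith)
  have hmn' : m = n := by
    by_contra hne
    exact (Real.one_lt_cosh.2 (dist_pos.2 hne).ne').ne' hmn
  exact hmn' ▸ hn p

/-- The Gram determinant of three points of the hyperbolic plane has a constant sign. -/
theorem UpperHalfPlane.cosh_dist_gram_nonneg (a b c : ℍ) :
    0 ≤ 1 + 2 * Real.cosh (dist a b) * Real.cosh (dist a c) * Real.cosh (dist b c)
      - Real.cosh (dist a b) ^ 2 - Real.cosh (dist a c) ^ 2 - Real.cosh (dist b c) ^ 2 := by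
  have h₁ : Real.cosh (dist b c) ≤ Real.cosh (dist a b + dist a c) := by
    rw [Real.cosh_le_cosh, abs_of_nonneg dist_nonneg, abs_of_nonneg (by positivity)]
    exact dist_triangle_left b c a
  have h₂ : Real.cosh (dist a b - dist a c) ≤ Real.cosh (dist b c) := by
    rw [Real.cosh_le_cosh, abs_of_nonneg (dist_nonneg (x := b)), dist_comm a b, dist_comm a c]
    exact abs_dist_sub_le b c a
  rw [Real.cosh_add] at h₁
  rw [Real.cosh_sub] at h₂
  have h := mul_nonneg (sub_nonneg.2 h₁) (sub_nonneg.2 h₂)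
  have hs₁ := Real.sinh_sq (dist a b)
  have hs₂ := Real.sinh_sq (dist a c)
  have hs : Real.sinh (dist a b) ^ 2 * Real.sinh (dist a c) ^ 2 =
      (Real.cosh (dist a b) ^ 2 - 1) * (Real.cosh (dist a c) ^ 2 - 1) := by rw [hs₁, hs₂]
  linarith

/-- The segment joining the midpoints of two sides of a hyperbolic triangle is at most half as
long as the third side. -/
theorem UpperHalfPlane.dist_le_half_dist_of_median {a b c m n : ℍ}
    (hm : ∀ p : ℍ, 2 * Real.cosh (dist a b / 2) * Real.cosh (dist p m) =
      Real.cosh (dist p a) + Real.cosh (dist p b))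
    (hn : ∀ p : ℍ, 2 * Real.cosh (dist a c / 2) * Real.cosh (dist p n) =
      Real.cosh (dist p a) + Real.cosh (dist p c)) :
    dist m n ≤ dist b c / 2 := by
  have hsq (x : ℝ) : 2 * Real.cosh (x / 2) ^ 2 = 1 + Real.cosh x := by
    conv_rhs => rw [show x = 2 * (x / 2) by ring, Real.cosh_two_mul, Real.sinh_sq]
    ring
  have hb := Real.cosh_pos (dist a b / 2)
  have hc := Real.cosh_pos (dist a c / 2)
  have hbc := Real.cosh_pos (dist b c / 2)
  have key : 4 * Real.cosh (dist a b / 2) * Real.cosh (dist a c / 2) * Real.cosh (dist m n) =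
      1 + Real.cosh (dist a b) + Real.cosh (dist a c) + Real.cosh (dist b c) := by
    have ha := hm a
    have hc' := hm c
    rw [dist_self, Real.cosh_zero] at ha
    rw [dist_comm c m, dist_comm c a, dist_comm c b] at hc'
    have h := hn m
    rw [dist_comm m a] at h
    linear_combination 2 * Real.cosh (dist a b / 2) * h + ha + hc'
  have hle : 4 * Real.cosh (dist a b / 2) * Real.cosh (dist a c / 2) * Real.cosh (dist m n) ≤
      4 * Real.cosh (dist a b / 2) * Real.cosh (dist a c / 2) * Real.cosh (dist b c / 2) := by
    refine le_of_sq_le_sq ?_ (by positivity)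
    rw [key]
    have hprod : (4 * Real.cosh (dist a b / 2) * Real.cosh (dist a c / 2) *
        Real.cosh (dist b c / 2)) ^ 2 = 2 * (1 + Real.cosh (dist a b)) *
        (1 + Real.cosh (dist a c)) * (1 + Real.cosh (dist b c)) := by
      rw [← hsq, ← hsq, ← hsq]
      ring
    rw [hprod]
    linarith [UpperHalfPlane.cosh_dist_gram_nonneg a b c]
  have h := le_of_mul_le_mul_left hle (by positivity)
  rwa [Real.cosh_le_cosh, abs_of_nonneg dist_nonneg, abs_of_nonneg (by positivity)] at h

/-- **Midpoint contraction in the hyperbolic plane** (the key estimate behind Lemma 4.4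
and Theorem 4.6 of the paper): if `m` is a hyperbolic midpoint of `a, b` and `m'` is a
hyperbolic midpoint of `a', b'`, then `dist m m' ≤ (dist a a' + dist b b') / 2`. -/
theorem hyperbolic_midpoint_contraction (a b a' b' m m' : ℍ)
    (hm₁ : dist a m = dist a b / 2) (hm₂ : dist m b = dist a b / 2)
    (hm'₁ : dist a' m' = dist a' b' / 2) (hm'₂ : dist m' b' = dist a' b' / 2) :
    dist m m' ≤ (dist a a' + dist b b') / 2 := by
  obtain ⟨n, hn⟩ := UpperHalfPlane.exists_cosh_dist_median a b'
  have h₁ : dist m n ≤ dist b b' / 2 :=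
    UpperHalfPlane.dist_le_half_dist_of_median (UpperHalfPlane.cosh_dist_of_midpoint hm₁ hm₂) hn
  have h₂ : dist n m' ≤ dist a a' / 2 := by
    refine UpperHalfPlane.dist_le_half_dist_of_median (a := b') (fun p ↦ ?_) (fun p ↦ ?_)
    · rw [dist_comm b' a, hn p, add_comm]
    · rw [dist_comm b' a', UpperHalfPlane.cosh_dist_of_midpoint hm'₁ hm'₂ p, add_comm]
  linarith [dist_triangle m n m']
end

section
/- For all t ≥ 0 and all s, d ∈ ℝ: if d ≥ (1/2)·log(1 + e^{−s}), then e^t·d ≥ (1/2)·log(1 + e^{−e^t·s}). (This is the inequality verified in the proof of Lemma 5.14 of the paper, guaranteeing that the stretched horocyclic foliation of a quadrilateral piece remains inside the horocyclic foliation of the stretched piece.) -/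
/-- The inequality verified in the proof of Lemma 5.14 of the paper: for `t ≥ 0`, if
`d ≥ (1/2)·log(1 + e^{-s})` then `e^t·d ≥ (1/2)·log(1 + e^{-e^t·s})`.  It guarantees
that the stretched horocyclic foliation of a quadrilateral piece remains inside the
horocyclic foliation of the stretched piece. -/
theorem stretched_horocyclic_foliation_quadrilateral (t s d : ℝ) (ht : 0 ≤ t)
    (hd : 1 / 2 * Real.log (1 + Real.exp (-s)) ≤ d) :
    1 / 2 * Real.log (1 + Real.exp (-(Real.exp t * s))) ≤ Real.exp t * d := by
  have hk : 1 ≤ Real.exp t := Real.one_le_exp ht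
  have hpow : 1 + Real.exp (-(Real.exp t * s)) ≤ (1 + Real.exp (-s)) ^ Real.exp t := by
    have h := Real.add_rpow_le_rpow_add zero_le_one (Real.exp_pos (-s)).le hk
    rwa [Real.one_rpow, ← Real.exp_mul, neg_mul, mul_comm s] at h
  have hlog := Real.log_le_log (by positivity) hpow
  rw [Real.log_rpow (by positivity)] at hlog
  have hmul := mul_le_mul_of_nonneg_left hd (Real.exp_pos t).le
  linarith
end

section
/- For all t ≥ 0 and all s₁, s₂, d ∈ ℝ with s₁ ≤ s₂ and s₁ + s₂ ≥ 0: if d ≥ s₂/2 + (1/2)·log((e^{s₁}+1)/(e^{s₂}+1)), then e^t·d ≥ e^t·s₂/2 + (1/2)·log((e^{e^t·s₁}+1)/(e^{e^t·s₂}+1)). (This is the inequality verified in the proof of Lemma 5.16 of the paper, guaranteeing that the stretched horocyclic foliation of a pentagonal piece remains inside the horocyclic foliation of the stretched piece; equivalently, for λ = e^t ≥ 1 one has (e^{s₁}+1)^λ·(e^{λs₂}+1) ≥ (e^{λs₁}+1)·(e^{s₂}+1)^λ.) -/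
open Set in
/-- The defect of homogeneity `c * log (exp x + 1) - log (exp (c * x) + 1)` of the softplus function
is decreasing on the nonnegative reals when `1 ≤ c`. -/
theorem antitoneOn_softplus_defect {c : ℝ} (hc : 1 ≤ c) :
    AntitoneOn (fun x : ℝ => c * Real.log (Real.exp x + 1) - Real.log (Real.exp (c * x) + 1))
      (Ici 0) := by
  have hderiv (x : ℝ) : HasDerivAt
      (fun x : ℝ => c * Real.log (Real.exp x + 1) - Real.log (Real.exp (c * x) + 1))
      (c * (Real.exp x / (Real.exp x + 1)) - Real.exp (c * x) * (c * 1) / (Real.exp (c * x) + 1))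
      x :=
    ((((Real.hasDerivAt_exp x).add_const 1).log (by positivity)).const_mul c).sub
      (((((hasDerivAt_id x).const_mul c).exp).add_const 1).log (by positivity))
  refine antitoneOn_of_deriv_nonpos (convex_Ici 0)
    (fun x _ => (hderiv x).continuousAt.continuousWithinAt)
    (fun x _ => (hderiv x).differentiableAt.differentiableWithinAt) fun x hx => ?_
  rw [interior_Ici, mem_Ioi] at hx
  have hexp : Real.exp x ≤ Real.exp (c * x) := Real.exp_le_exp.2 (by nlinarith)
  have hfrac : Real.exp x / (Real.exp x + 1) ≤ Real.exp (c * x) / (Real.exp (c * x) + 1) := by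
    rw [div_le_div_iff₀ (by positivity) (by positivity)]
    linarith
  rw [(hderiv x).deriv, mul_one, mul_comm (Real.exp (c * x)), mul_div_assoc]
  exact sub_nonpos.2 (mul_le_mul_of_nonneg_left hfrac (by linarith))

theorem log_exp_neg_add_one (x : ℝ) :
    Real.log (Real.exp (-x) + 1) = Real.log (Real.exp x + 1) - x := by
  have h : Real.exp (-x) + 1 = (Real.exp x + 1) / Real.exp x := by
    rw [Real.exp_neg]
    field_simp
    ring
  rw [h, Real.log_div (by positivity) (by positivity), Real.log_exp]


/-- The inequality verified in the proof of Lemma 5.16 of the paper: for `t ≥ 0` and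
pentagon parameters `s₁ ≤ s₂` with `s₁ + s₂ ≥ 0`, if
`d ≥ s₂/2 + (1/2)·log((e^{s₁}+1)/(e^{s₂}+1))` then
`e^t·d ≥ e^t·s₂/2 + (1/2)·log((e^{e^t·s₁}+1)/(e^{e^t·s₂}+1))`.  It guarantees that the
stretched horocyclic foliation of a pentagonal piece remains inside the horocyclic
foliation of the stretched piece. -/
theorem stretched_horocyclic_foliation_pentagon (t s₁ s₂ d : ℝ) (ht : 0 ≤ t)
    (hle : s₁ ≤ s₂) (hsum : 0 ≤ s₁ + s₂)
    (hd : s₂ / 2 + 1 / 2 * Real.log ((Real.exp s₁ + 1) / (Real.exp s₂ + 1)) ≤ d) :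
    Real.exp t * s₂ / 2 + 1 / 2 *
        Real.log ((Real.exp (Real.exp t * s₁) + 1) / (Real.exp (Real.exp t * s₂) + 1)) ≤
      Real.exp t * d := by
  have hc : 1 ≤ Real.exp t := Real.one_le_exp ht
  rw [Real.log_div (by positivity) (by positivity)] at hd ⊢
  generalize Real.exp t = c at hc ⊢
  have hdefect : c * Real.log (Real.exp s₂ + 1) - Real.log (Real.exp (c * s₂) + 1) ≤
      c * Real.log (Real.exp s₁ + 1) - Real.log (Real.exp (c * s₁) + 1) := by
    rcases le_total 0 s₁ with h | h
    · exact antitoneOn_softplus_defect hc h (h.trans hle) hle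
    · have key := antitoneOn_softplus_defect hc (a := -s₁) (b := s₂)
        (by simpa using h) (Set.mem_Ici.2 (by linarith)) (by linarith)
      simp only [mul_neg, log_exp_neg_add_one] at key
      linarith
  have hscaled := mul_le_mul_of_nonneg_left hd (by linarith : 0 ≤ c)
  linarith
end

section
/- Let s₁, s₂ ∈ ℝ with s₁ + s₂ > 0, and set r = √(e^{s₂}(e^{s₁}+1)/(e^{s₂}+1)) and W = (e^{s₁+s₂} − 1)/(e^{s₂} + 1). Then r > 1, W + 1 = r², and the hyperbolic distance in ℍ between the points O_W = −1 + i·r² and E = −1 + i·r equals s₂/2 + (1/2)·log((e^{s₁}+1)/(e^{s₂}+1)). (This is the unnumbered lemma of Section 5.6 of the paper: the point O_W, the nearest-point projection of the ideal point W onto the vertical geodesic through −1 and ∞, lies on the half-line above E at the stated distance.) -/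
open UpperHalfPlane

/-- The unnumbered lemma of Section 5.6 of the paper: with
`r = √(e^{s₂}(e^{s₁}+1)/(e^{s₂}+1))` and `W = (e^{s₁+s₂}-1)/(e^{s₂}+1)` (with
`s₁ + s₂ > 0`), one has `r > 1`, `W + 1 = r²`, and the point `O_W = -1 + i·r²` lies on
the half-line above `E = -1 + i·r` at hyperbolic distance
`s₂/2 + (1/2)·log((e^{s₁}+1)/(e^{s₂}+1))`. -/
theorem pentagon_O_W_distance (s₁ s₂ : ℝ) (hsum : 0 < s₁ + s₂)
    (r W : ℝ)
    (hr : r = Real.sqrt (Real.exp s₂ * (Real.exp s₁ + 1) / (Real.exp s₂ + 1)))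
    (hW : W = (Real.exp (s₁ + s₂) - 1) / (Real.exp s₂ + 1))
    (OW E : ℍ) (hOW : (OW : ℂ) = ⟨-1, r ^ 2⟩) (hE : (E : ℂ) = ⟨-1, r⟩) :
    1 < r ∧ W + 1 = r ^ 2 ∧
      dist OW E = s₂ / 2 + 1 / 2 * Real.log ((Real.exp s₁ + 1) / (Real.exp s₂ + 1)) := by
  have h₁ := Real.exp_pos s₁
  have h₂ := Real.exp_pos s₂
  have hsq : r ^ 2 = Real.exp s₂ * (Real.exp s₁ + 1) / (Real.exp s₂ + 1) := by
    rw [hr, Real.sq_sqrt (by positivity)]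
  have hexp : 1 < Real.exp s₁ * Real.exp s₂ := by
    rw [← Real.exp_add]
    exact Real.one_lt_exp_iff.2 hsum
  have hr1 : 1 < r := by
    rw [hr, Real.lt_sqrt zero_le_one, one_pow, one_lt_div (by positivity)]
    linarith
  refine ⟨hr1, ?_, ?_⟩
  · rw [hsq, hW, Real.exp_add]
    field_simp
    ring
  · have hre : OW.re = E.re := by
      rw [← coe_re, ← coe_re, hOW, hE]
    have hOim : OW.im = r ^ 2 := by rw [← coe_im, hOW]
    have hEim : E.im = r := by rw [← coe_im, hE]
    have hlog : 2 * Real.log r =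
        s₂ + Real.log ((Real.exp s₁ + 1) / (Real.exp s₂ + 1)) := by
      rw [← Nat.cast_two, ← Real.log_pow, hsq, mul_div_assoc,
        Real.log_mul h₂.ne' (by positivity), Real.log_exp]
    have hdist : dist OW E = Real.log r := by
      rw [dist_of_re_eq hre, hOim, hEim, Real.dist_eq, Real.log_pow, Nat.cast_two,
        two_mul, add_sub_cancel_right, abs_of_pos (Real.log_pos hr1)]
    rw [hdist]
    linarith
end
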